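/- Let f : ℝ^n → ℝ ∪ {+∞} be convex piecewise linear and let x ∈ ℝ^n with f(x) < +∞. Then dim({y ∈ ℝ^n | ∂f(y) = ∂f(x)}) + dim(∂f(x)) = n. -/

import Mathlib

noncomputable section

/-- A polyhedral set: a finite intersection of closed halfspaces. -/
def IsPolyhedron {n : ℕ} (P : Set (Fin n → ℝ)) : Prop :=
  ∃ (k : ℕ) (a : Fin k → (Fin n → ℝ)) (β : Fin k → ℝ),
    P = {x | ∀ i, ∑ j, a i j * x j ≤ β i}

/-- Convex piecewise linear function with values in ℝ ∪ {+∞}: the maximum of finitely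
many (at least one) affine functions on a polyhedral set `P`, and `+∞` outside `P`. -/
def IsCPWL {n : ℕ} (f : (Fin n → ℝ) → EReal) : Prop :=
  ∃ (k : ℕ) (v : Fin (k + 1) → (Fin n → ℝ)) (w : Fin (k + 1) → ℝ) (P : Set (Fin n → ℝ)),
    IsPolyhedron P ∧
    (∀ x ∈ P, f x =
      (((Finset.univ.sup' Finset.univ_nonempty fun i => ∑ j, v i j * x j + w i : ℝ)) : EReal)) ∧
    (∀ x ∉ P, f x = ⊤)

/-- The subdifferential of `f` at `x`:
`{v | f y ≥ f x + ⟨v, y - x⟩ for all y}`, read in ℝ ∪ {+∞}. -/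
def subdiff {n : ℕ} (f : (Fin n → ℝ) → EReal) (x : Fin n → ℝ) : Set (Fin n → ℝ) :=
  {v | ∀ y, f x + ((∑ j, v j * (y j - x j) : ℝ) : EReal) ≤ f y}

/-- Dimension of a set: the dimension of the linear span of differences of its elements. -/
def setDim {n : ℕ} (S : Set (Fin n → ℝ)) : ℕ :=
  Module.finrank ℝ (Submodule.span ℝ {d : Fin n → ℝ | ∃ s ∈ S, ∃ s' ∈ S, d = s - s'})

/-- Row space of a matrix: the range of `Aᵀ`. -/
def rowSpace {m n : ℕ} (A : Matrix (Fin m) (Fin n) ℝ) : Set (Fin n → ℝ) :=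
  {v | ∃ z : Fin m → ℝ, v = Matrix.vecMul z A}

/-- Nullity of a matrix: the dimension of its kernel. -/
def nullity {m n : ℕ} (A : Matrix (Fin m) (Fin n) ℝ) : ℕ :=
  Module.finrank ℝ (LinearMap.ker A.mulVecLin)

/-- Solution set `S(b) = argmin_x D(Ax, b) + f(x)` of the regularized regression problem. -/
def solSet {m n : ℕ} (D : (Fin m → ℝ) → (Fin m → ℝ) → ℝ) (A : Matrix (Fin m) (Fin n) ℝ)
    (f : (Fin n → ℝ) → EReal) (b : Fin m → ℝ) : Set (Fin n → ℝ) :=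
  {x | ∀ y, ((D (A.mulVec x) b : ℝ) : EReal) + f x ≤ ((D (A.mulVec y) b : ℝ) : EReal) + f y}

/-- The least squares data fidelity `(1/2)‖z - b‖₂²`. -/
def lsq {m : ℕ} (z b : Fin m → ℝ) : ℝ := (1 / 2) * ∑ i, (z i - b i) ^ 2

/-- Smooth data fidelity: `z ↦ D(z, b)` is strictly convex and differentiable for each `b`,
with gradient (in the first argument) `g z b`, and `b ↦ g z b = ∇_z D(z, b)` is a bijection
of `ℝ^m` for each `z`. -/
def IsSmoothDataFidelity {m : ℕ} (D : (Fin m → ℝ) → (Fin m → ℝ) → ℝ)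
    (g : (Fin m → ℝ) → (Fin m → ℝ) → (Fin m → ℝ)) : Prop :=
  (∀ b, StrictConvexOn ℝ Set.univ fun z => D z b) ∧
  (∀ b, Differentiable ℝ fun z => D z b) ∧
  (∀ z b v, fderiv ℝ (fun z' => D z' b) z v = ∑ i, g z b i * v i) ∧
  (∀ z, Function.Bijective fun b => g z b)

open scoped Topology

/-- The maximum of the affine functions `x ↦ v i ⬝ᵥ x + w i`. -/
def maxAffine {n k : ℕ} (v : Fin (k + 1) → (Fin n → ℝ)) (w : Fin (k + 1) → ℝ)
    (x : Fin n → ℝ) : ℝ :=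
  Finset.univ.sup' Finset.univ_nonempty fun i => v i ⬝ᵥ x + w i

/-- The intersection of the halfspaces `a j ⬝ᵥ x ≤ β j`. -/
def halfspaces {n m : ℕ} (a : Fin m → (Fin n → ℝ)) (β : Fin m → ℝ) : Set (Fin n → ℝ) :=
  {x | ∀ j, a j ⬝ᵥ x ≤ β j}

/-- If the differences of `S` annihilate those of `T`, and every vector annihilated by the
differences of `S` lies in the span of the differences of `T`, then the dimensions of `S` and `T`
are complementary. -/
lemma setDim_add_setDim_of_orthogonal {n : ℕ} {S T : Set (Fin n → ℝ)}
    (horth : ∀ s ∈ S, ∀ s' ∈ S, ∀ t ∈ T, ∀ t' ∈ T, (s - s') ⬝ᵥ (t - t') = 0)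
    (hspan : ∀ d : Fin n → ℝ, (∀ s ∈ S, ∀ s' ∈ S, (s - s') ⬝ᵥ d = 0) →
      d ∈ Submodule.span ℝ {d : Fin n → ℝ | ∃ s ∈ T, ∃ s' ∈ T, d = s - s'}) :
    setDim T + setDim S = n := by
  set WS := Submodule.span ℝ {d : Fin n → ℝ | ∃ s ∈ S, ∃ s' ∈ S, d = s - s'}
  set e := dotProductEquiv ℝ (Fin n)
  have hT : Submodule.span ℝ {d : Fin n → ℝ | ∃ s ∈ T, ∃ s' ∈ T, d = s - s'} =
      (WS.map e.toLinearMap).dualCoannihilator := by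
    apply le_antisymm
    · rw [Submodule.span_le]
      rintro _ ⟨t, ht, t', ht', rfl⟩
      rw [SetLike.mem_coe, Submodule.mem_dualCoannihilator]
      rintro _ ⟨u, hu, rfl⟩
      change u ⬝ᵥ (t - t') = 0
      induction hu using Submodule.span_induction with
      | mem u hu =>
        obtain ⟨s, hs, s', hs', rfl⟩ := hu
        exact horth s hs s' hs' t ht t' ht'
      | zero => simp
      | add a b _ _ ha hb => rw [add_dotProduct, ha, hb, add_zero]
      | smul c a _ ha => rw [smul_dotProduct, ha, smul_zero]
    · intro d hd
      rw [Submodule.mem_dualCoannihilator] at hd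
      exact hspan d fun s hs s' hs' =>
        hd _ (Submodule.mem_map_of_mem (Submodule.subset_span ⟨s, hs, s', hs', rfl⟩))
  have h := Subspace.finrank_add_finrank_dualCoannihilator_eq (WS.map e.toLinearMap)
  rw [← hT, LinearEquiv.finrank_map_eq, Module.finrank_fin_fun] at h
  rw [add_comm]
  exact h

section

variable {n k m : ℕ} {v : Fin (k + 1) → (Fin n → ℝ)} {w : Fin (k + 1) → ℝ}
  {a : Fin m → (Fin n → ℝ)} {β : Fin m → ℝ} {f : (Fin n → ℝ) → EReal}

lemma le_maxAffine (i : Fin (k + 1)) (x : Fin n → ℝ) : v i ⬝ᵥ x + w i ≤ maxAffine v w x :=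
  Finset.le_sup' (fun i => v i ⬝ᵥ x + w i) (Finset.mem_univ i)

lemma maxAffine_le_iff {x : Fin n → ℝ} {c : ℝ} :
    maxAffine v w x ≤ c ↔ ∀ i, v i ⬝ᵥ x + w i ≤ c := by
  simp [maxAffine]

lemma exists_eq_maxAffine (v : Fin (k + 1) → (Fin n → ℝ)) (w : Fin (k + 1) → ℝ)
    (x : Fin n → ℝ) : ∃ i, v i ⬝ᵥ x + w i = maxAffine v w x := by
  obtain ⟨i, -, hi⟩ := Finset.exists_mem_eq_sup' Finset.univ_nonempty fun i => v i ⬝ᵥ x + w i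
  exact ⟨i, hi.symm⟩

lemma mem_subdiff_iff (hfin : ∀ x ∈ halfspaces a β, f x = maxAffine v w x)
    (htop : ∀ x ∉ halfspaces a β, f x = ⊤) {x p : Fin n → ℝ} (hx : x ∈ halfspaces a β) :
    p ∈ subdiff f x ↔
      ∀ y ∈ halfspaces a β, maxAffine v w x + p ⬝ᵥ (y - x) ≤ maxAffine v w y := by
  constructor
  · intro hp y hy
    have h := hp y
    rw [hfin x hx, hfin y hy] at h
    exact_mod_cast h
  · intro hp y
    by_cases hy : y ∈ halfspaces a β
    · rw [hfin x hx, hfin y hy]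
      exact_mod_cast hp y hy
    · rw [htop y hy]
      exact le_top

/-- The strict inequality `c < b` persists along short segments. -/
lemma eventually_add_smul_lt (u x d : Fin n → ℝ) {c b r : ℝ} (h : u ⬝ᵥ x + c < b) :
    ∀ᶠ s : ℝ in 𝓝[>] 0, u ⬝ᵥ (x + s • d) + c < b + s * r := by
  have hc : Continuous fun s : ℝ => u ⬝ᵥ (x + s • d) + c := by
    simp only [dotProduct_add, dotProduct_smul]; fun_prop
  have hb : Continuous fun s : ℝ => b + s * r := by fun_prop
  exact nhdsWithin_le_nhds (hc.continuousAt.eventually_lt hb.continuousAt (by simpa using h))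

lemma eventually_add_smul_mem_halfspaces {x d : Fin n → ℝ} (hx : x ∈ halfspaces a β)
    (hd : ∀ j, a j ⬝ᵥ x = β j → a j ⬝ᵥ d ≤ 0) :
    ∀ᶠ s : ℝ in 𝓝[>] 0, x + s • d ∈ halfspaces a β := by
  refine Filter.eventually_all.2 fun j => ?_
  rcases (hx j).eq_or_lt with h | h
  · filter_upwards [self_mem_nhdsWithin] with s hs
    have := mul_nonpos_of_nonneg_of_nonpos (le_of_lt hs) (hd j h)
    simp only [dotProduct_add, dotProduct_smul, smul_eq_mul]
    linarith
  · filter_upwards [eventually_add_smul_lt (a j) x d (c := 0) (r := 0) (by simpa using h)]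
      with s hs
    simpa using hs.le

lemma eventually_maxAffine_add_smul_le {x d : Fin n → ℝ} {r : ℝ}
    (hr : ∀ i, v i ⬝ᵥ x + w i = maxAffine v w x → v i ⬝ᵥ d ≤ r) :
    ∀ᶠ s : ℝ in 𝓝[>] 0, maxAffine v w (x + s • d) ≤ maxAffine v w x + s * r := by
  simp only [maxAffine_le_iff]
  refine Filter.eventually_all.2 fun i => ?_
  rcases (le_maxAffine (v := v) (w := w) i x).eq_or_lt with h | h
  · filter_upwards [self_mem_nhdsWithin] with s hs
    have := mul_le_mul_of_nonneg_left (hr i h) (le_of_lt hs)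
    simp only [dotProduct_add, dotProduct_smul, smul_eq_mul]
    linarith
  · filter_upwards [eventually_add_smul_lt (v i) x d h] with s hs using hs.le

/-- The subdifferential only grows with the sets of active affine pieces and constraints. -/
lemma subdiff_subset_of_active (hfin : ∀ x ∈ halfspaces a β, f x = maxAffine v w x)
    (htop : ∀ x ∉ halfspaces a β, f x = ⊤) {x y : Fin n → ℝ}
    (hx : x ∈ halfspaces a β) (hy : y ∈ halfspaces a β)
    (hv : ∀ i, v i ⬝ᵥ x + w i = maxAffine v w x → v i ⬝ᵥ y + w i = maxAffine v w y)
    (ha : ∀ j, a j ⬝ᵥ x = β j → a j ⬝ᵥ y = β j) :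
    subdiff f x ⊆ subdiff f y := by
  intro p hp
  rw [mem_subdiff_iff hfin htop hx] at hp
  rw [mem_subdiff_iff hfin htop hy]
  intro z hz
  have hr : ∀ i, v i ⬝ᵥ x + w i = maxAffine v w x →
      v i ⬝ᵥ (z - y) ≤ maxAffine v w z - maxAffine v w y := by
    intro i hi
    have h1 := hv i hi
    have h2 := le_maxAffine (v := v) (w := w) i z
    rw [dotProduct_sub]
    linarith
  have hd : ∀ j, a j ⬝ᵥ x = β j → a j ⬝ᵥ (z - y) ≤ 0 := by
    intro j hj
    have h1 := ha j hj
    have h2 := hz j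
    rw [dotProduct_sub]
    linarith
  obtain ⟨s, ⟨h1, h2⟩, hs⟩ := (((eventually_add_smul_mem_halfspaces hx hd).and
    (eventually_maxAffine_add_smul_le hr)).and self_mem_nhdsWithin).exists
  have hs : 0 < s := hs
  have h3 := hp _ h1
  rw [add_sub_cancel_left, dotProduct_smul, smul_eq_mul] at h3
  have h4 : p ⬝ᵥ (z - y) ≤ maxAffine v w z - maxAffine v w y :=
    le_of_mul_le_mul_left (by linarith) hs
  linarith

/-- Moving a little in a direction which is constant on the active affine pieces and tangent to
the active constraints does not change the subdifferential. -/
lemma exists_subdiff_add_smul_eq (hfin : ∀ x ∈ halfspaces a β, f x = maxAffine v w x)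
    (htop : ∀ x ∉ halfspaces a β, f x = ⊤) {x d : Fin n → ℝ} {r : ℝ}
    (hx : x ∈ halfspaces a β)
    (hv : ∀ i, v i ⬝ᵥ x + w i = maxAffine v w x → v i ⬝ᵥ d = r)
    (ha : ∀ j, a j ⬝ᵥ x = β j → a j ⬝ᵥ d = 0) :
    ∃ s : ℝ, 0 < s ∧ subdiff f (x + s • d) = subdiff f x := by
  have hvlt : ∀ᶠ s : ℝ in 𝓝[>] 0, ∀ i, v i ⬝ᵥ x + w i < maxAffine v w x →
      v i ⬝ᵥ (x + s • d) + w i < maxAffine v w x + s * r :=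
    Filter.eventually_all.2 fun i => Filter.eventually_imp_distrib_left.2
      fun h => eventually_add_smul_lt (v i) x d h
  have halt : ∀ᶠ s : ℝ in 𝓝[>] 0, ∀ j, a j ⬝ᵥ x + 0 < β j →
      a j ⬝ᵥ (x + s • d) + 0 < β j + s * 0 :=
    Filter.eventually_all.2 fun j => Filter.eventually_imp_distrib_left.2
      fun h => eventually_add_smul_lt (a j) x d h
  obtain ⟨s, ⟨⟨⟨h1, h2⟩, h3⟩, h4⟩, hs⟩ := ((((eventually_add_smul_mem_halfspaces hx
    fun j hj => (ha j hj).le).and (eventually_maxAffine_add_smul_le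
    fun i hi => (hv i hi).le)).and hvlt).and halt |>.and self_mem_nhdsWithin).exists
  have hmove : ∀ u : Fin n → ℝ, u ⬝ᵥ (x + s • d) = u ⬝ᵥ x + s * (u ⬝ᵥ d) := fun u => by
    rw [dotProduct_add, dotProduct_smul, smul_eq_mul]
  have hmax : maxAffine v w (x + s • d) = maxAffine v w x + s * r := by
    obtain ⟨i, hi⟩ := exists_eq_maxAffine v w x
    have h := le_maxAffine (v := v) (w := w) i (x + s • d)
    rw [hmove, hv i hi] at h
    exact le_antisymm h2 (by linarith)
  refine ⟨s, hs, Set.Subset.antisymm ?_ ?_⟩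
  · refine subdiff_subset_of_active hfin htop h1 hx (fun i hi => ?_) fun j hj => ?_
    · refine (le_maxAffine i x).eq_or_lt.resolve_right fun h => ?_
      have := h3 i h
      linarith
    · refine (hx j).eq_or_lt.resolve_right fun h => ?_
      have := h4 j (by linarith)
      linarith
  · refine subdiff_subset_of_active hfin htop hx h1 (fun i hi => ?_) fun j hj => ?_
    · rw [hmove, hv i hi, hmax]
      linarith
    · rw [hmove, ha j hj]
      linarith

end

/-- Duality of dimensions: the set of constant subdifferential and the subdifferential
have complementary dimensions. -/
theorem dim_constantSubdiff_add_dim_subdiff {n : ℕ} (f : (Fin n → ℝ) → EReal)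
    (hf : IsCPWL f) (x : Fin n → ℝ) (hx : f x < ⊤) :
    setDim {y : Fin n → ℝ | subdiff f y = subdiff f x} + setDim (subdiff f x) = n := by
  obtain ⟨k, v, w, P, ⟨m, a, β, rfl⟩, hfin, htop⟩ := hf
  change ∀ y ∈ halfspaces a β, f y = maxAffine v w y at hfin
  change ∀ y ∉ halfspaces a β, f y = ⊤ at htop
  have hmem : ∀ y, f y < ⊤ → y ∈ halfspaces a β := fun y hy => by
    by_contra h
    exact hy.ne (htop y h)
  have hxP := hmem x hx
  have hactive : ∀ i, v i ⬝ᵥ x + w i = maxAffine v w x → v i ∈ subdiff f x := by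
    intro i hi
    rw [mem_subdiff_iff hfin htop hxP]
    intro y _
    have := le_maxAffine (v := v) (w := w) i y
    rw [dotProduct_sub]
    linarith
  obtain ⟨i₀, hi₀⟩ := exists_eq_maxAffine v w x
  have hconst : ∀ y, subdiff f y = subdiff f x → y ∈ halfspaces a β := by
    intro y hy
    by_contra h
    have h1 : v i₀ ∈ subdiff f y := hy ▸ hactive i₀ hi₀
    have h2 := h1 x
    rw [htop y h, EReal.top_add_coe] at h2
    exact hx.ne (top_le_iff.1 h2)
  apply setDim_add_setDim_of_orthogonal
  · intro p hp q hq y hy z hz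
    have key : ∀ p ∈ subdiff f x, p ⬝ᵥ (y - z) = maxAffine v w y - maxAffine v w z := by
      intro p hp
      have hpy : p ∈ subdiff f y := hy ▸ hp
      have hpz : p ∈ subdiff f z := hz ▸ hp
      have h1 := (mem_subdiff_iff hfin htop (hconst y hy)).1 hpy z (hconst z hz)
      have h2 := (mem_subdiff_iff hfin htop (hconst z hz)).1 hpz y (hconst y hy)
      rw [dotProduct_sub] at h1 h2 ⊢
      linarith
    rw [sub_dotProduct, key p hp, key q hq, sub_self]
  · intro d hd
    obtain ⟨s, hs, h⟩ := exists_subdiff_add_smul_eq hfin htop (d := d) (r := v i₀ ⬝ᵥ d) hxP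
      (fun i hi => by
        have := hd _ (hactive i hi) _ (hactive i₀ hi₀)
        rw [sub_dotProduct] at this
        linarith)
      (fun j hj => by
        have hj' : v i₀ + a j ∈ subdiff f x := by
          rw [mem_subdiff_iff hfin htop hxP]
          intro y hy
          have h1 := le_maxAffine (v := v) (w := w) i₀ y
          have h2 : a j ⬝ᵥ y ≤ β j := hy j
          rw [add_dotProduct, dotProduct_sub, dotProduct_sub]
          linarith
        simpa using hd _ hj' _ (hactive i₀ hi₀))
    have hsd : s • d ∈ Submodule.span ℝ {d : Fin n → ℝ |
        ∃ t ∈ {y : Fin n → ℝ | subdiff f y = subdiff f x},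
          ∃ t' ∈ {y : Fin n → ℝ | subdiff f y = subdiff f x}, d = t - t'} :=
      Submodule.subset_span ⟨x + s • d, h, x, rfl, by simp⟩
    exact (Submodule.smul_mem_iff _ hs.ne').1 hsd

end
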